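/- Let H ∈ ℤ[X] be a nonzero polynomial with ‖H‖_∞ ≥ 2, let 0 < ε < 1, and let λ ≥ max(21, (10/(3ε))·ln ‖H‖_∞) be a real number. If q is chosen uniformly at random among the primes in the interval [λ, 2λ], then with probability at least 1 − ε/2 the reduction of H modulo q (reducing every coefficient modulo q) is a nonzero polynomial over ℤ/qℤ. -/

import Mathlib

open Polynomial

attribute [local instance] Classical.propDecidable

/-- The height `‖H‖_∞` of an integer polynomial: the maximum absolute value of
its coefficients. -/
def heightZ (H : Polynomial ℤ) : ℕ := H.support.sup fun i => (H.coeff i).natAbs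

theorem log_factorial_eq_sum_vonMangoldt {n N : ℕ} (h : n ≤ N) :
    Real.log n.factorial =
      ∑ d ∈ Finset.Ioc 0 N, ArithmeticFunction.vonMangoldt d * ((n / d : ℕ) : ℝ) := by
  induction n with
  | zero => simp
  | succ n ih =>
    have hdiv : ∀ d : ℕ, (((n + 1) / d : ℕ) : ℝ) = (n / d : ℕ) + if d ∣ n + 1 then 1 else 0 := by
      intro d
      rw [Nat.succ_div]
      split_ifs <;> simp
    rw [Nat.factorial_succ, Nat.cast_mul, Real.log_mul (by positivity) (by positivity),
      ih (by omega), ← ArithmeticFunction.vonMangoldt_sum]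
    simp only [hdiv, mul_add, Finset.sum_add_distrib, mul_ite, mul_one, mul_zero]
    rw [← Finset.sum_filter, add_comm]
    congr 1
    apply Finset.sum_congr _ fun _ _ => rfl
    ext d
    simp only [Nat.mem_divisors, Finset.mem_filter, Finset.mem_Ioc]
    constructor
    · rintro ⟨hd, -⟩
      exact ⟨⟨Nat.pos_of_dvd_of_pos hd (by omega), (Nat.le_of_dvd (by omega) hd).trans h⟩, hd⟩
    · exact fun hd => ⟨hd.2, by omega⟩

/-- Chebyshev's combination of log-factorials. -/
noncomputable def chebyshevCombination (n : ℕ) : ℝ :=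
  Real.log n.factorial - Real.log (n / 2).factorial - Real.log (n / 3).factorial
    - Real.log (n / 5).factorial + Real.log (n / 30).factorial

/-- The coefficient of `Λ d` in `chebyshevCombination n` when `y = n / d`. -/
def chebyshevWeight (y : ℕ) : ℤ := y - (y / 2 : ℕ) - (y / 3 : ℕ) - (y / 5 : ℕ) + (y / 30 : ℕ)

theorem chebyshevWeight_nonneg (y : ℕ) : 0 ≤ chebyshevWeight y := by
  unfold chebyshevWeight; omega

theorem chebyshevWeight_le_one (y : ℕ) : chebyshevWeight y ≤ 1 := by
  unfold chebyshevWeight; omega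

theorem chebyshevWeight_eq_one {y : ℕ} (h1 : 1 ≤ y) (h6 : y < 6) : chebyshevWeight y = 1 := by
  unfold chebyshevWeight; omega

theorem chebyshevCombination_eq_sum (n : ℕ) :
    chebyshevCombination n =
      ∑ d ∈ Finset.Ioc 0 n, ArithmeticFunction.vonMangoldt d * (chebyshevWeight (n / d) : ℝ) := by
  unfold chebyshevCombination
  rw [log_factorial_eq_sum_vonMangoldt le_rfl,
    log_factorial_eq_sum_vonMangoldt (Nat.div_le_self n 2),
    log_factorial_eq_sum_vonMangoldt (Nat.div_le_self n 3),
    log_factorial_eq_sum_vonMangoldt (Nat.div_le_self n 5),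
    log_factorial_eq_sum_vonMangoldt (Nat.div_le_self n 30)]
  simp only [← Finset.sum_sub_distrib, ← Finset.sum_add_distrib]
  refine Finset.sum_congr rfl fun d _ => ?_
  simp only [chebyshevWeight, Nat.div_div_eq_div_mul, mul_comm d]
  rw [Int.cast_add, Int.cast_sub, Int.cast_sub, Int.cast_sub]
  simp only [Int.cast_natCast]
  ring

theorem chebyshevCombination_le_psi (n : ℕ) : chebyshevCombination n ≤ Chebyshev.psi n := by
  rw [chebyshevCombination_eq_sum, Chebyshev.psi, Nat.floor_natCast]
  refine Finset.sum_le_sum fun d _ => ?_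
  exact mul_le_of_le_one_right ArithmeticFunction.vonMangoldt_nonneg
    (by exact_mod_cast chebyshevWeight_le_one _)

theorem psi_le_chebyshevCombination_add (n : ℕ) :
    Chebyshev.psi n ≤ chebyshevCombination n + Chebyshev.psi (n / 6 : ℕ) := by
  have hsub : Finset.Ioc 0 (n / 6) ⊆ Finset.Ioc 0 n :=
    Finset.Ioc_subset_Ioc_right (Nat.div_le_self n 6)
  rw [chebyshevCombination_eq_sum, Chebyshev.psi, Chebyshev.psi, Nat.floor_natCast,
    Nat.floor_natCast, ← Finset.sum_sdiff hsub]
  gcongr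
  rw [← Finset.sum_sdiff hsub]
  refine le_add_of_le_of_nonneg (Finset.sum_le_sum fun d hd => ?_) (Finset.sum_nonneg fun d _ => ?_)
  · simp only [Finset.mem_sdiff, Finset.mem_Ioc, not_and, not_le] at hd
    have h6 := hd.2 hd.1.1
    rw [chebyshevWeight_eq_one]
    · simp
    · exact (Nat.one_le_div_iff hd.1.1).2 hd.1.2
    · rw [Nat.div_lt_iff_lt_mul hd.1.1]; omega
  · exact mul_nonneg ArithmeticFunction.vonMangoldt_nonneg
      (by exact_mod_cast chebyshevWeight_nonneg _)

theorem log_factorial_le {m : ℕ} (hm : m ≠ 0) :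
    Real.log m.factorial ≤ m * Real.log m - m + Real.log m / 2 + 1 := by
  obtain ⟨k, rfl⟩ := Nat.exists_eq_succ_of_ne_zero hm
  have h := Stirling.log_stirlingSeq'_antitone (Nat.zero_le k)
  simp only [Function.comp] at h
  rw [Stirling.log_stirlingSeq_formula, Nat.succ_eq_add_one, Nat.succ_eq_add_one, zero_add,
    Stirling.stirlingSeq_one,
    Real.log_mul (by norm_num) (by positivity), Real.log_div (by positivity) (by positivity),
    Real.log_exp, Real.log_div (by positivity) (by positivity), Real.log_exp,
    Real.log_sqrt (by norm_num)] at h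
  rw [Nat.succ_eq_add_one]
  linarith

theorem le_log_factorial {m : ℕ} (hm : m ≠ 0) :
    m * Real.log m - m ≤ Real.log m.factorial := by
  have h := Stirling.le_log_factorial_stirling hm
  have h1 : 0 ≤ Real.log m := Real.log_natCast_nonneg m
  have h2 : 0 ≤ Real.log (2 * Real.pi) := Real.log_nonneg (by linarith [Real.pi_gt_three])
  linarith

/-- `log ⌊y⌋! = y log y - y + O(log y)`, for `y = n / k`. -/
theorem abs_log_factorial_div_sub_le {n k : ℕ} (hk : 0 < k) (hkn : k ≤ n) :
    |Real.log (n / k).factorial - ((n / k : ℝ) * Real.log (n / k) - n / k)| ≤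
      Real.log (n / k) + 1 := by
  set m := n / k with hm
  set y : ℝ := (n : ℝ) / k with hy
  have hm1 : 1 ≤ m := (Nat.one_le_div_iff hk).2 hkn
  have hm1' : (1 : ℝ) ≤ m := by exact_mod_cast hm1
  have hmy : (m : ℝ) ≤ y := Nat.cast_div_le
  have hym : y ≤ m + 1 := by
    rw [hy, div_le_iff₀ (by exact_mod_cast hk)]
    have : n < k * (n / k + 1) := Nat.lt_mul_div_succ n hk
    rw [mul_comm] at this
    exact_mod_cast this.le
  have hm0 : (0 : ℝ) < m := by linarith
  have hy0 : 0 < y := by linarith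
  have hlog : Real.log m ≤ Real.log y := Real.log_le_log (by linarith) hmy
  have hlm : 0 ≤ Real.log m := Real.log_nonneg hm1'
  have hF : (m : ℝ) * Real.log m - m ≤ y * Real.log y - y := by
    have h1 : Real.log (m / y) ≤ m / y - 1 := Real.log_le_sub_one_of_pos (by positivity)
    rw [Real.log_div (by positivity) (by positivity)] at h1
    have h2 : y * (Real.log m - Real.log y) ≤ m - y := by
      have := mul_le_mul_of_nonneg_left h1 (show 0 ≤ y by linarith)
      have h3 : y * (m / y - 1) = m - y := by field_simp
      linarith
    nlinarith [mul_nonneg (sub_nonneg.2 hmy) hlm]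
  have hF' : y * Real.log y - y - Real.log y ≤ m * Real.log m - m := by
    have h1 : Real.log (y / m) ≤ y / m - 1 := Real.log_le_sub_one_of_pos (by positivity)
    rw [Real.log_div (by positivity) (by positivity)] at h1
    have h2 : m * (Real.log y - Real.log m) ≤ y - m := by
      have := mul_le_mul_of_nonneg_left h1 (show (0 : ℝ) ≤ m by linarith)
      have h3 : m * (y / m - 1) = y - m := by field_simp
      linarith
    nlinarith [mul_nonneg (sub_nonneg.2 hym) (hlm.trans hlog)]
  have hU := log_factorial_le (m := m) (by omega)
  have hL := le_log_factorial (m := m) (by omega)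
  rw [abs_le]
  constructor <;> linarith

theorem abs_chebyshevCombination_sub_le {n : ℕ} (hn : 30 ≤ n) :
    |chebyshevCombination n -
      (14 * Real.log 2 + 9 * Real.log 3 + 5 * Real.log 5) / 30 * n| ≤ 5 * Real.log n + 5 := by
  have h1 := abs_log_factorial_div_sub_le (n := n) (k := 1) (by norm_num) (by omega)
  have h2 := abs_log_factorial_div_sub_le (n := n) (k := 2) (by norm_num) (by omega)
  have h3 := abs_log_factorial_div_sub_le (n := n) (k := 3) (by norm_num) (by omega)
  have h5 := abs_log_factorial_div_sub_le (n := n) (k := 5) (by norm_num) (by omega)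
  have h30 := abs_log_factorial_div_sub_le (n := n) (k := 30) (by norm_num) (by omega)
  have hn0 : (n : ℝ) ≠ 0 := by positivity
  have e30 : Real.log 30 = Real.log 2 + Real.log 3 + Real.log 5 := by
    rw [← Real.log_mul, ← Real.log_mul] <;> norm_num
  have p2 : 0 < Real.log 2 := Real.log_pos (by norm_num)
  have p3 : 0 < Real.log 3 := Real.log_pos (by norm_num)
  have p5 : 0 < Real.log 5 := Real.log_pos (by norm_num)
  simp only [Nat.div_one, Nat.cast_one, div_one] at h1
  rw [Nat.cast_ofNat, Real.log_div hn0 (by norm_num), abs_le] at h2 h3 h5 h30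
  rw [e30] at h30
  rw [abs_le] at h1 ⊢
  unfold chebyshevCombination
  constructor <;> linarith [h1.1, h1.2, h2.1, h2.2, h3.1, h3.2, h5.1, h5.2, h30.1, h30.2]

theorem chebyshevConstant_bounds :
    0.92 ≤ (14 * Real.log 2 + 9 * Real.log 3 + 5 * Real.log 5) / 30 ∧
      (14 * Real.log 2 + 9 * Real.log 3 + 5 * Real.log 5) / 30 ≤ 0.93 := by
  have e : 5 * (14 * Real.log 2 + 9 * Real.log 3 + 5 * Real.log 5) =
      Real.log ((2 ^ 14 * 3 ^ 9 * 5 ^ 5) ^ 5) := by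
    rw [Real.log_pow, Real.log_mul (by norm_num) (by norm_num),
      Real.log_mul (by norm_num) (by norm_num), Real.log_pow, Real.log_pow, Real.log_pow]
    push_cast; ring
  have lo : 138 ≤ Real.log ((2 ^ 14 * 3 ^ 9 * 5 ^ 5) ^ 5) := by
    rw [Real.le_log_iff_exp_le (by norm_num), show (138 : ℝ) = (138 : ℕ) * 1 by norm_num,
      Real.exp_nat_mul]
    exact (pow_le_pow_left₀ (Real.exp_pos 1).le Real.exp_one_lt_d9.le 138).trans (by norm_num)
  have hi : Real.log ((2 ^ 14 * 3 ^ 9 * 5 ^ 5) ^ 5) ≤ 139 := by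
    rw [Real.log_le_iff_le_exp (by norm_num), show (139 : ℝ) = (139 : ℕ) * 1 by norm_num,
      Real.exp_nat_mul]
    exact le_trans (by norm_num) (pow_le_pow_left₀ (by norm_num) Real.exp_one_gt_d9.le 139)
  constructor <;> linarith

theorem log_le_div_add {x c : ℝ} (hx : 0 < x) (hc : 0 < c) :
    Real.log x ≤ x / c + Real.log c - 1 := by
  have := Real.log_le_sub_one_of_pos (div_pos hx hc)
  rw [Real.log_div hx.ne' hc.ne'] at this
  linarith

theorem lcmUpto_sq_le {n : ℕ} (hn : n < 100) : Nat.lcmUpto n ^ 2 ≤ 20 ^ n := by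
  revert n
  unfold Nat.lcmUpto
  decide +kernel

theorem psi_natCast_le (n : ℕ) : Chebyshev.psi n ≤ 3 / 2 * n := by
  induction n using Nat.strong_induction_on with
  | _ n ih =>
    rcases lt_or_ge n 100 with hn | hn
    · have h1 : ((Nat.lcmUpto n : ℝ)) ^ 2 ≤ 20 ^ n := by exact_mod_cast lcmUpto_sq_le hn
      have hpos : (0 : ℝ) < Nat.lcmUpto n := by exact_mod_cast Nat.lcmUpto_pos n
      have h2 := Real.log_le_log (by positivity) h1
      have h3 : Real.log 20 ≤ 3 := by
        rw [Real.log_le_iff_le_exp (by norm_num), show (3 : ℝ) = (3 : ℕ) * 1 by norm_num,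
          Real.exp_nat_mul]
        exact le_trans (by norm_num) (pow_le_pow_left₀ (by norm_num) Real.exp_one_gt_d9.le 3)
      rw [Real.log_pow, Real.log_pow, Nat.cast_ofNat] at h2
      rw [Chebyshev.psi_eq_log_lcmUpto]
      have := mul_le_mul_of_nonneg_left h3 (Nat.cast_nonneg (α := ℝ) n)
      linarith
    · have h1 := psi_le_chebyshevCombination_add n
      have h2 := ih (n / 6) (by omega)
      have h3 := (abs_le.1 (abs_chebyshevCombination_sub_le (n := n) (by omega))).2
      have h4 : ((n / 6 : ℕ) : ℝ) ≤ n / 6 := by exact_mod_cast Nat.cast_div_le (α := ℝ)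
      have hn' : (100 : ℝ) ≤ n := by exact_mod_cast hn
      have h5 := mul_le_mul_of_nonneg_right chebyshevConstant_bounds.2 (Nat.cast_nonneg (α := ℝ) n)
      have h6 := log_le_div_add (x := n) (c := 100) (by linarith) (by norm_num)
      have h7 : 10 * Real.log 100 ≤ 47 := by
        rw [← Nat.cast_ofNat (R := ℝ) (n := 10), ← Real.log_pow,
          Real.log_le_iff_le_exp (by norm_num), show (47 : ℝ) = (47 : ℕ) * 1 by norm_num,
          Real.exp_nat_mul]
        exact le_trans (by norm_num) (pow_le_pow_left₀ (by norm_num) Real.exp_one_gt_d9.le 47)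
      linarith

theorem psi_le_three_halves_mul {x : ℝ} (hx : 0 ≤ x) : Chebyshev.psi x ≤ 3 / 2 * x := by
  rw [Chebyshev.psi_eq_psi_coe_floor]
  have := Nat.floor_le hx
  linarith [psi_natCast_le ⌊x⌋₊]

theorem psi_sub_theta_le_mul_sqrt_self {x : ℝ} (hx : 15625 ≤ x) :
    Chebyshev.psi x - Chebyshev.theta x ≤ 21 / 10 * √x := by
  have hx0 : 0 ≤ x := by linarith
  have h := Chebyshev.psi_sub_theta_le_psi_add_psi_add_psi x
  have h2 := psi_le_three_halves_mul (Real.rpow_nonneg hx0 (2 : ℝ)⁻¹)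
  have h3 := psi_le_three_halves_mul (Real.rpow_nonneg hx0 (3 : ℝ)⁻¹)
  have h5 := psi_le_three_halves_mul (Real.rpow_nonneg hx0 (5 : ℝ)⁻¹)
  have h53 : x ^ (5 : ℝ)⁻¹ ≤ x ^ (3 : ℝ)⁻¹ :=
    Real.rpow_le_rpow_of_exponent_le (by linarith) (by norm_num)
  have h6 : 5 ≤ x ^ (6 : ℝ)⁻¹ := by
    have : (5 : ℝ) = 15625 ^ (6 : ℝ)⁻¹ := by
      rw [show (15625 : ℝ) = 5 ^ (6 : ℝ) by norm_num, ← Real.rpow_mul (by norm_num)]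
      norm_num
    calc (5 : ℝ) = 15625 ^ (6 : ℝ)⁻¹ := this
      _ ≤ _ := Real.rpow_le_rpow (by norm_num) hx (by norm_num)
  have h32 : 5 * x ^ (3 : ℝ)⁻¹ ≤ √x := by
    calc 5 * x ^ (3 : ℝ)⁻¹ ≤ x ^ (6 : ℝ)⁻¹ * x ^ (3 : ℝ)⁻¹ := by gcongr
      _ = √x := by
        rw [← Real.rpow_add (by linarith), Real.sqrt_eq_rpow]
        norm_num
  rw [show x ^ (2 : ℝ)⁻¹ = √x by rw [Real.sqrt_eq_rpow]; norm_num] at h h2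
  linarith

theorem theta_sub_theta_half_le (n : ℕ) :
    Chebyshev.theta n - Chebyshev.theta (n / 2 : ℕ) ≤
      (((Finset.Ioc (n / 2) n).filter Nat.Prime).card : ℝ) * Real.log n := by
  have hsub : Finset.Ioc 0 (n / 2) ⊆ Finset.Ioc 0 n :=
    Finset.Ioc_subset_Ioc_right (Nat.div_le_self n 2)
  have hsplit : Finset.Ioc 0 n \ Finset.Ioc 0 (n / 2) = Finset.Ioc (n / 2) n := by
    ext d
    simp only [Finset.mem_sdiff, Finset.mem_Ioc]
    omega
  rw [Chebyshev.theta, Chebyshev.theta, Nat.floor_natCast, Nat.floor_natCast, Finset.sum_filter,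
    Finset.sum_filter, ← Finset.sum_sdiff hsub, add_sub_cancel_right, hsplit, ← Finset.sum_filter,
    ← nsmul_eq_mul]
  refine Finset.sum_le_card_nsmul _ _ _ fun p hp => ?_
  simp only [Finset.mem_filter, Finset.mem_Ioc] at hp
  exact Real.log_le_log (by exact_mod_cast hp.2.pos) (by exact_mod_cast hp.1.2)

theorem le_card_primes_mul_log_of_large {n : ℕ} (hn : 15625 ≤ n) :
    3 / 10 * ((n : ℝ) + 1) ≤
      (((Finset.Ioc (n / 2) n).filter Nat.Prime).card : ℝ) * Real.log (((n : ℝ) + 1) / 2) := by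
  have hn' : (15625 : ℝ) ≤ n := by exact_mod_cast hn
  set N : ℝ := (((Finset.Ioc (n / 2) n).filter Nat.Prime).card : ℝ) with hN
  have hN0 : 0 ≤ N := Nat.cast_nonneg _
  set L := Real.log n with hL
  have hθ := theta_sub_theta_half_le n
  have hψθ := psi_sub_theta_le_mul_sqrt_self (x := n) (by linarith)
  have hθψ := Chebyshev.theta_le_psi ((n / 2 : ℕ) : ℝ)
  have h1 := chebyshevCombination_le_psi n
  have h2 := psi_le_chebyshevCombination_add (n / 2)
  have h3 := (abs_le.1 (abs_chebyshevCombination_sub_le (n := n) (by omega))).1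
  have h4 := (abs_le.1 (abs_chebyshevCombination_sub_le (n := n / 2) (by omega))).2
  have h5 := psi_le_chebyshevCombination_add (n / 2 / 6)
  have h6 := (abs_le.1 (abs_chebyshevCombination_sub_le (n := n / 2 / 6) (by omega))).2
  have h7 := psi_natCast_le (n / 2 / 6 / 6)
  have hhalf : ((n / 2 : ℕ) : ℝ) ≤ n / 2 := by exact_mod_cast Nat.cast_div_le (α := ℝ)
  have htwelfth : ((n / 2 / 6 : ℕ) : ℝ) ≤ n / 12 := by
    rw [Nat.div_div_eq_div_mul]
    exact_mod_cast Nat.cast_div_le (α := ℝ)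
  have hseventysecond : ((n / 2 / 6 / 6 : ℕ) : ℝ) ≤ n / 72 := by
    rw [Nat.div_div_eq_div_mul, Nat.div_div_eq_div_mul]
    exact_mod_cast Nat.cast_div_le (α := ℝ)
  have hlogtwelfth : Real.log ((n / 2 / 6 : ℕ) : ℝ) ≤ L :=
    Real.log_le_log (by exact_mod_cast (by omega : 0 < n / 2 / 6))
      (by exact_mod_cast (by omega : n / 2 / 6 ≤ n))
  have hloghalf : Real.log ((n / 2 : ℕ) : ℝ) ≤ L :=
    Real.log_le_log (by exact_mod_cast (by omega : 0 < n / 2))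
      (by exact_mod_cast Nat.div_le_self n 2)
  obtain ⟨hA, hA'⟩ := chebyshevConstant_bounds
  set A := (14 * Real.log 2 + 9 * Real.log 3 + 5 * Real.log 5) / 30 with hAdef
  have hAhalf : A * ((n / 2 : ℕ) : ℝ) ≤ A * (n / 2) :=
    mul_le_mul_of_nonneg_left hhalf (by linarith)
  have hAtwelfth : A * ((n / 2 / 6 : ℕ) : ℝ) ≤ 0.93 * (n / 12) :=
    mul_le_mul hA' htwelfth (Nat.cast_nonneg _) (by norm_num)
  have hAn : 0.92 * (n / 2 : ℝ) ≤ A * (n / 2) := mul_le_mul_of_nonneg_right hA (by linarith)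
  have hsqrt : 125 * √(n : ℝ) ≤ n := by
    have h125 : 125 ≤ √(n : ℝ) := Real.le_sqrt_of_sq_le (by linarith)
    nlinarith [Real.mul_self_sqrt (show (0 : ℝ) ≤ n by linarith)]
  have hLlo : 48 ≤ 5 * L := by
    rw [hL, ← Nat.cast_ofNat (R := ℝ) (n := 5), ← Real.log_pow,
      Real.le_log_iff_exp_le (by positivity), show (48 : ℝ) = (48 : ℕ) * 1 by norm_num,
      Real.exp_nat_mul]
    exact (pow_le_pow_left₀ (Real.exp_pos 1).le Real.exp_one_lt_d9.le 48).trans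
      (le_trans (by norm_num) (pow_le_pow_left₀ (by norm_num) hn' 5))
  have hLhi : L ≤ n / 15625 + Real.log 15625 - 1 := log_le_div_add (by linarith) (by norm_num)
  have hlog : Real.log 15625 ≤ 10 := by
    rw [Real.log_le_iff_le_exp (by norm_num), show (10 : ℝ) = (10 : ℕ) * 1 by norm_num,
      Real.exp_nat_mul]
    exact le_trans (by norm_num) (pow_le_pow_left₀ (by norm_num) Real.exp_one_gt_d9.le 10)
  have hL2 : L - Real.log 2 ≤ Real.log (((n : ℝ) + 1) / 2) := by
    rw [hL, ← Real.log_div (by linarith) (by norm_num)]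
    exact Real.log_le_log (by linarith) (by linarith)
  have hlog2 := Real.log_two_lt_d9
  have hNL : 0.343 * n - 151 ≤ N * L := by linarith
  have hratio : 0.9277 * L ≤ Real.log (((n : ℝ) + 1) / 2) := by linarith
  have hfin := mul_le_mul_of_nonneg_left hratio hN0
  nlinarith

/-- The product of the primes below `137`. -/
def primeProduct : ℕ :=
  525896479052627740771371797072411912900610967452630

theorem prime_of_gcd_eq_one {m B P : ℕ} (h1 : 1 < m) (h2 : m < B ^ 2)
    (hP : ∀ p < B, p.Prime → p ∣ P) (h : m.gcd P = 1) : m.Prime := by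
  by_contra hm
  have hp := Nat.minFac_prime h1.ne'
  have hsq := Nat.minFac_sq_le_self (by omega) hm
  have hlt : m.minFac < B := lt_of_pow_lt_pow_left₀ 2 (Nat.zero_le B) (hsq.trans_lt h2)
  have := Nat.dvd_gcd (Nat.minFac_dvd m) (hP _ hlt hp)
  rw [h] at this
  exact hp.one_lt.ne' (Nat.dvd_one.1 this)

theorem dvd_of_factorial_dvd_pow {p B P k : ℕ} (hpB : p ≤ B) (hp : p.Prime)
    (h : B.factorial ∣ P ^ k) : p ∣ P :=
  hp.dvd_of_dvd_pow ((hp.dvd_factorial.2 hpB).trans h)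

/-- A primality test, valid for `1 < m < 137 ^ 2`: below `17 ^ 2` it suffices to be coprime to
`30030 = 2 * 3 * 5 * 7 * 11 * 13`. -/
def primeTest (m : ℕ) : Bool :=
  Nat.beq (m.gcd (bif Nat.ble m 288 then 30030 else primeProduct)) 1

theorem prime_of_primeTest {m : ℕ} (h1 : 1 < m) (h2 : m < 18769) (h : primeTest m = true) :
    m.Prime := by
  rw [primeTest, Nat.beq_eq, cond_eq_ite] at h
  split_ifs at h with hm <;> rw [Nat.ble_eq] at hm
  · refine prime_of_gcd_eq_one h1 (B := 17) (by omega) (fun p hpB hp => ?_) h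
    exact dvd_of_factorial_dvd_pow (Nat.le_of_lt_succ hpB) hp (k := 16)
      (Nat.dvd_of_mod_eq_zero (by decide +kernel))
  · refine prime_of_gcd_eq_one h1 (B := 137) (by omega) (fun p hpB hp => ?_) h
    exact dvd_of_factorial_dvd_pow (Nat.le_of_lt_succ hpB) hp (k := 137)
      (Nat.dvd_of_mod_eq_zero (by decide +kernel))

/-- The number of `m ∈ [lo, hi]` with `m < lo + 2 ^ k` that pass `primeTest`. -/
def primeTestCount (hi : ℕ) : ℕ → ℕ → ℕ
  | 0, lo => bif Nat.ble lo hi && primeTest lo then 1 else 0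
  | k + 1, lo =>
    bif Nat.ble (lo + 2 ^ k) hi then primeTestCount hi k lo + primeTestCount hi k (lo + 2 ^ k)
    else primeTestCount hi k lo

theorem primeTestCount_le {hi : ℕ} (hhi : hi < 18769) (k : ℕ) {lo : ℕ} (hlo : 1 < lo) :
    primeTestCount hi k lo ≤
      ((Finset.Ico lo (lo + 2 ^ k)).filter fun m => m ≤ hi ∧ m.Prime).card := by
  induction k generalizing lo with
  | zero =>
    rw [primeTestCount, cond_eq_ite]
    split_ifs with h
    · rw [Bool.and_eq_true, Nat.ble_eq] at h
      exact Finset.card_pos.2 ⟨lo, by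
        simp [h.1, prime_of_primeTest hlo (by omega) h.2]⟩
    · exact Nat.zero_le _
  | succ k ih =>
    rw [primeTestCount, cond_eq_ite]
    have hpow : 2 ^ (k + 1) = 2 ^ k + 2 ^ k := by ring
    split_ifs with h <;> rw [Nat.ble_eq] at h
    · refine (add_le_add (ih hlo) (ih (hlo.trans_le (Nat.le_add_right _ _)))).trans ?_
      rw [← Finset.card_union_of_disjoint]
      · refine Finset.card_le_card fun m hm => ?_
        simp only [Finset.mem_union, Finset.mem_filter, Finset.mem_Ico] at hm ⊢
        rcases hm with hm | hm <;> exact ⟨by omega, hm.2⟩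
      · refine Finset.disjoint_filter_filter (Finset.disjoint_left.2 fun m hm hm' => ?_)
        simp only [Finset.mem_Ico] at hm hm'
        omega
    · refine (ih hlo).trans (Finset.card_le_card fun m hm => ?_)
      simp only [Finset.mem_filter, Finset.mem_Ico] at hm ⊢
      exact ⟨by omega, hm.2⟩

/-- A criterion implying the prime count estimate for all `n ∈ [a, b]`: here `l / 20` is a lower
bound for `log ((a + 1) / 2)`. -/
def rangeCheck (s : ℕ × ℕ × ℕ) : Bool :=
  decide (42 ≤ s.1) && decide (s.2.1 < 18769) &&
    decide (27182818286 ^ s.2.2 * 2 ^ 20 ≤ (s.1 + 1) ^ 20 * 10000000000 ^ s.2.2) &&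
    decide (6 * (s.2.1 + 1) ≤ primeTestCount s.1 14 (s.2.1 / 2 + 1) * s.2.2)

theorem le_card_primes_mul_log_of_rangeCheck {a b l n : ℕ} (h : rangeCheck (a, b, l) = true)
    (han : a ≤ n) (hnb : n ≤ b) :
    3 / 10 * ((n : ℝ) + 1) ≤
      (((Finset.Ioc (n / 2) n).filter Nat.Prime).card : ℝ) * Real.log (((n : ℝ) + 1) / 2) := by
  simp only [rangeCheck, Bool.and_eq_true, decide_eq_true_eq] at h
  obtain ⟨⟨⟨ha, hb⟩, hlog⟩, hcount⟩ := h
  have hcard : primeTestCount a 14 (b / 2 + 1) ≤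
      ((Finset.Ioc (n / 2) n).filter Nat.Prime).card := by
    refine (primeTestCount_le (by omega) 14 (by omega)).trans (Finset.card_le_card fun m hm => ?_)
    simp only [Finset.mem_filter, Finset.mem_Ico, Finset.mem_Ioc] at hm ⊢
    exact ⟨by omega, hm.2.2⟩
  have hN : 6 * ((n : ℝ) + 1) ≤ (((Finset.Ioc (n / 2) n).filter Nat.Prime).card : ℝ) * l := by
    have := hcount.trans (Nat.mul_le_mul_right l hcard)
    exact_mod_cast (show 6 * (n + 1) ≤ 6 * (b + 1) by omega).trans this
  have hl : (l : ℝ) ≤ 20 * Real.log (((n : ℝ) + 1) / 2) := by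
    have hle : ((a : ℝ) + 1) / 2 ≤ ((n : ℝ) + 1) / 2 := by
      have : (a : ℝ) ≤ n := by exact_mod_cast han
      linarith
    refine le_trans ?_ (mul_le_mul_of_nonneg_left
      (Real.log_le_log (by positivity) hle) (by norm_num))
    have h20 : 20 * Real.log (((a : ℝ) + 1) / 2) = Real.log ((((a : ℝ) + 1) / 2) ^ 20) := by
      rw [Real.log_pow]; norm_num
    rw [h20, Real.le_log_iff_exp_le (by positivity), ← mul_one (l : ℝ), Real.exp_nat_mul]
    refine (pow_le_pow_left₀ (Real.exp_pos 1).le Real.exp_one_lt_d9.le l).trans ?_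
    have hlog' : (27182818286 : ℝ) ^ l * 2 ^ 20 ≤ ((a : ℝ) + 1) ^ 20 * 10000000000 ^ l := by
      exact_mod_cast hlog
    rw [show (2.7182818286 : ℝ) = 27182818286 / 10000000000 by norm_num, div_pow, div_pow,
      div_le_div_iff₀ (by positivity) (by positivity)]
    exact hlog'
  nlinarith [Nat.cast_nonneg (α := ℝ) ((Finset.Ioc (n / 2) n).filter Nat.Prime).card]

/-- Triples `(a, b, l)` satisfying `rangeCheck` whose intervals `[a, b]` cover `[42, 15625)`. -/
def primeRanges : List (ℕ × ℕ × ℕ) :=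
  [(42, 45, 61), (46, 51, 63), (52, 57, 65), (58, 61, 67),
    (62, 73, 68), (74, 85, 72), (86, 99, 75), (100, 116, 78),
    (117, 141, 81), (142, 165, 85), (166, 193, 88), (194, 225, 91),
    (226, 261, 94), (262, 306, 97), (307, 361, 100), (362, 432, 104),
    (433, 516, 107), (517, 621, 111), (622, 757, 114), (758, 913, 118),
    (914, 1113, 122), (1114, 1345, 126), (1346, 1641, 130), (1642, 2017, 134),
    (2018, 2445, 138), (2446, 2977, 142), (2978, 3624, 146), (3625, 4425, 150),
    (4426, 5389, 154), (5390, 6517, 157), (6518, 7893, 161), (7894, 9624, 165),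
    (9625, 11733, 169), (11734, 14257, 173), (14258, 17413, 177)]

theorem primeRanges_rangeCheck : ∀ s ∈ primeRanges, rangeCheck s = true := by
  decide +kernel

theorem exists_primeRange {n : ℕ} (h1 : 42 ≤ n) (h2 : n < 15625) :
    ∃ s ∈ primeRanges, s.1 ≤ n ∧ n ≤ s.2.1 := by
  simp only [primeRanges, List.mem_cons, exists_eq_or_imp, List.not_mem_nil, false_and,
    exists_false]
  omega

theorem le_card_primes_mul_log {n : ℕ} (hn : 42 ≤ n) :
    3 / 10 * ((n : ℝ) + 1) ≤
      (((Finset.Ioc (n / 2) n).filter Nat.Prime).card : ℝ) * Real.log (((n : ℝ) + 1) / 2) := by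
  rcases lt_or_ge n 15625 with h | h
  · obtain ⟨⟨a, b, l⟩, hs, h1, h2⟩ := exists_primeRange hn h
    exact le_card_primes_mul_log_of_rangeCheck (primeRanges_rangeCheck _ hs) h1 h2
  · exact le_card_primes_mul_log_of_large h

/-- There are at least `(3 / 5) x / log x` primes in `[x, 2x]` for `x ≥ 21`. -/
theorem le_card_primes_Icc_mul_log {x : ℝ} (hx : 21 ≤ x) :
    3 / 5 * x ≤ (((Finset.Icc ⌈x⌉₊ ⌊2 * x⌋₊).filter Nat.Prime).card : ℝ) * Real.log x := by
  set n := ⌊2 * x⌋₊ with hn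
  have hn42 : 42 ≤ n := Nat.le_floor (by norm_num; linarith)
  have hxn : 2 * x < n + 1 := Nat.lt_floor_add_one _
  have hxt : x ≤ ((n : ℝ) + 1) / 2 := by linarith
  have hcard : ((Finset.Ioc (n / 2) n).filter Nat.Prime).card ≤
      ((Finset.Icc ⌈x⌉₊ n).filter Nat.Prime).card := by
    refine Finset.card_le_card (Finset.filter_subset_filter _ fun m hm => ?_)
    rw [Finset.mem_Ioc] at hm
    rw [Finset.mem_Icc]
    refine ⟨Nat.ceil_le.2 ?_, hm.2⟩
    have : n + 1 ≤ 2 * m := by omega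
    have : (n : ℝ) + 1 ≤ 2 * m := by exact_mod_cast this
    linarith
  have hcard' : (((Finset.Ioc (n / 2) n).filter Nat.Prime).card : ℝ) ≤
      (((Finset.Icc ⌈x⌉₊ n).filter Nat.Prime).card : ℝ) := by exact_mod_cast hcard
  have h := le_card_primes_mul_log hn42
  have he : Real.exp 1 ≤ x := by linarith [Real.exp_one_lt_d9]
  have hanti := Real.log_div_self_antitoneOn (Set.mem_Ici.2 he)
    (Set.mem_Ici.2 (he.trans hxt)) hxt
  simp only at hanti
  set t := ((n : ℝ) + 1) / 2 with ht
  set N := (((Finset.Ioc (n / 2) n).filter Nat.Prime).card : ℝ) with hN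
  have hN0 : 0 ≤ N := Nat.cast_nonneg _
  have hx0 : 0 < x := by linarith
  have ht0 : 0 < t := by linarith
  have h1 : 3 / 5 ≤ N * (Real.log t / t) := by
    rw [← mul_div_assoc, le_div_iff₀ ht0]
    linarith
  have h2 : 3 / 5 ≤ N * (Real.log x / x) :=
    h1.trans (mul_le_mul_of_nonneg_left hanti hN0)
  rw [← mul_div_assoc, le_div_iff₀ hx0] at h2
  exact h2.trans (mul_le_mul_of_nonneg_right hcard' (Real.log_nonneg (by linarith)))

theorem exists_natAbs_coeff_eq_heightZ {H : Polynomial ℤ} (hH : H ≠ 0) :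
    ∃ i, (H.coeff i).natAbs = heightZ H := by
  obtain ⟨i, -, hi⟩ := Finset.exists_mem_eq_sup H.support (Polynomial.support_nonempty.2 hH)
    fun i => (H.coeff i).natAbs
  exact ⟨i, hi.symm⟩

/-- If `H` vanishes modulo all primes `q ∈ S`, then `∏ q` divides the height. -/
theorem prod_primes_dvd_heightZ {H : Polynomial ℤ} (hH : H ≠ 0) {S : Finset ℕ}
    (hS : ∀ q ∈ S, q.Prime ∧ H.map (Int.castRingHom (ZMod q)) = 0) :
    ∏ q ∈ S, q ∣ heightZ H := by
  obtain ⟨i, hi⟩ := exists_natAbs_coeff_eq_heightZ hH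
  rw [← hi]
  refine Finset.prod_primes_dvd _ (fun q hq => (hS q hq).1.prime) fun q hq => ?_
  have h := congrArg (fun P => Polynomial.coeff P i) (hS q hq).2
  simp only [Polynomial.coeff_map, Polynomial.coeff_zero, eq_intCast] at h
  exact Int.natCast_dvd.1 ((ZMod.intCast_zmod_eq_zero_iff_dvd _ _).1 h)

/-- Let `H ∈ ℤ[X]` be nonzero with `‖H‖_∞ ≥ 2`, `0 < ε < 1`, and
`λ ≥ max(21, (10/(3ε))·ln ‖H‖_∞)`. A prime `q` chosen uniformly in `[λ, 2λ]`
satisfies `H mod q ≠ 0` (in `(ℤ/qℤ)[X]`) with probability at least `1 - ε/2`. -/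
theorem nonzero_mod_q_whp (H : Polynomial ℤ) (hH : H ≠ 0) (hheight : 2 ≤ heightZ H)
    (ε : ℝ) (hε0 : 0 < ε) (hε1 : ε < 1)
    (lam : ℝ) (hlam : max 21 (10 / (3 * ε) * Real.log (heightZ H)) ≤ lam) :
    (1 - ε / 2) * (((Finset.Icc ⌈lam⌉₊ ⌊2 * lam⌋₊).filter Nat.Prime).card : ℝ) ≤
      (((Finset.Icc ⌈lam⌉₊ ⌊2 * lam⌋₊).filter
          (fun q => Nat.Prime q ∧ H.map (Int.castRingHom (ZMod q)) ≠ 0)).card : ℝ) := by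
  have hlam21 : 21 ≤ lam := (le_max_left _ _).trans hlam
  have hlamH : 10 / (3 * ε) * Real.log (heightZ H) ≤ lam := (le_max_right _ _).trans hlam
  have hcount := le_card_primes_Icc_mul_log hlam21
  set S := (Finset.Icc ⌈lam⌉₊ ⌊2 * lam⌋₊).filter Nat.Prime with hSdef
  have hgood : (Finset.Icc ⌈lam⌉₊ ⌊2 * lam⌋₊).filter
      (fun q => Nat.Prime q ∧ H.map (Int.castRingHom (ZMod q)) ≠ 0) =
      S.filter (fun q => H.map (Int.castRingHom (ZMod q)) ≠ 0) := by
    rw [hSdef, Finset.filter_filter]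
  have hsplit := Finset.card_filter_add_card_filter_not (s := S)
    (fun q => H.map (Int.castRingHom (ZMod q)) = 0)
  set B := S.filter (fun q => H.map (Int.castRingHom (ZMod q)) = 0) with hBdef
  have hB : ∀ q ∈ B, (lam ≤ q ∧ q.Prime) ∧ H.map (Int.castRingHom (ZMod q)) = 0 := by
    intro q hq
    simp only [hBdef, hSdef, Finset.mem_filter, Finset.mem_Icc] at hq
    exact ⟨⟨Nat.ceil_le.1 hq.1.1.1, hq.1.2⟩, hq.2⟩
  have hdvd := prod_primes_dvd_heightZ hH fun q hq => ⟨(hB q hq).1.2, (hB q hq).2⟩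
  have hpow : lam ^ B.card ≤ (heightZ H : ℝ) := by
    calc lam ^ B.card = ∏ _q ∈ B, lam := by rw [Finset.prod_const]
      _ ≤ ∏ q ∈ B, (q : ℝ) :=
        Finset.prod_le_prod (fun _ _ => by linarith) fun q hq => (hB q hq).1.1
      _ ≤ (heightZ H : ℝ) := by
        rw [← Nat.cast_prod]
        exact_mod_cast Nat.le_of_dvd (by omega) hdvd
  have hBlog := Real.log_le_log (by positivity) hpow
  rw [Real.log_pow] at hBlog
  have hHlog : Real.log (heightZ H) ≤ 3 * ε / 10 * lam := by
    rw [div_mul_eq_mul_div, div_le_iff₀ (by positivity)] at hlamH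
    linarith
  have hlogpos : 0 < Real.log lam := Real.log_pos (by linarith)
  have hBN : (B.card : ℝ) ≤ ε / 2 * S.card := by
    refine le_of_mul_le_mul_right ?_ hlogpos
    have := mul_le_mul_of_nonneg_left hcount (show 0 ≤ ε / 2 by linarith)
    linarith
  have hsplit' : (B.card : ℝ) +
      (S.filter (fun q => H.map (Int.castRingHom (ZMod q)) ≠ 0)).card = S.card := by
    exact_mod_cast hsplit
  rw [hgood]
  linarith
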